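/- Let V be a type of propositional variables, F a set of clauses over V, and L = [ℓ₁, …, ℓₙ] a finite list of literals containing no literal together with its negation, such that for every index i there exists a clause R ∈ F that is unit in ℓᵢ under the set {ℓ₁, …, ℓ_{i-1}}. If some clause C ∈ F is falsified by the set {ℓ₁, …, ℓₙ}, then F is unsatisfiable: no total assignment v : V → Bool satisfies all clauses of F. (A conflict reached by unit propagation alone, without decisions, proves unsatisfiability.) -/

import Mathlib

/-- A literal is a variable paired with a Boolean polarity. -/
abbrev Lit (V : Type*) := V × Bool

/-- Negation of a literal flips its polarity. -/
def NegLit {V : Type*} (l : Lit V) : Lit V := (l.1, !l.2)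

/-- A clause is a finite set of literals. -/
abbrev Clause (V : Type*) := Finset (Lit V)

/-- A total assignment satisfies a literal `(x, b)` iff it maps `x` to `b`. -/
def SatLit {V : Type*} (v : V → Bool) (l : Lit V) : Prop := v l.1 = l.2

/-- A total assignment satisfies a clause iff it satisfies some literal of it. -/
def SatClause {V : Type*} (v : V → Bool) (C : Clause V) : Prop := ∃ l ∈ C, SatLit v l

/-- A set of clauses entails a clause iff every assignment satisfying all
clauses of the set satisfies the clause. -/
def Entails {V : Type*} (F : Set (Clause V)) (C : Clause V) : Prop :=
  ∀ v : V → Bool, (∀ D ∈ F, SatClause v D) → SatClause v C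

/-- A clause is falsified by a set `π` of literals if the negation of every
literal of the clause belongs to `π`. -/
def Falsified {V : Type*} (π : Set (Lit V)) (C : Clause V) : Prop :=
  ∀ l ∈ C, NegLit l ∈ π

/-- A clause `C` is unit in `ℓ` under a set `π` of literals if `ℓ ∈ C`, the
negation of `ℓ` is not in `π`, and the negation of every literal of `C \ {ℓ}`
is in `π`. -/
def UnitIn {V : Type*} [DecidableEq V] (π : Set (Lit V)) (C : Clause V) (ℓ : Lit V) : Prop :=
  ℓ ∈ C ∧ NegLit ℓ ∉ π ∧ ∀ m ∈ C \ {ℓ}, NegLit m ∈ π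

theorem not_satLit_negLit {V : Type*} {v : V → Bool} {l : Lit V} (h : SatLit v l) :
    ¬ SatLit v (NegLit l) := by
  simp_all [SatLit, NegLit]

/-- An assignment satisfying a clause and every literal of `π` satisfies each literal in which
the clause is unit under `π`. -/
theorem UnitIn.satLit {V : Type*} [DecidableEq V] {π : Set (Lit V)} {R : Clause V} {l : Lit V}
    {v : V → Bool} (h : UnitIn π R l) (hπ : ∀ m ∈ π, SatLit v m) (hR : SatClause v R) :
    SatLit v l := by
  obtain ⟨m, hm, hvm⟩ := hR
  by_cases hml : m = l
  · exact hml ▸ hvm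
  · exact absurd (hπ _ (h.2.2 m (by simp [hm, hml]))) (not_satLit_negLit hvm)

/-- An assignment satisfying every literal of `π` satisfies no clause falsified by `π`. -/
theorem Falsified.not_satClause {V : Type*} {π : Set (Lit V)} {C : Clause V} {v : V → Bool}
    (h : Falsified π C) (hπ : ∀ m ∈ π, SatLit v m) : ¬ SatClause v C := by
  rintro ⟨m, hm, hvm⟩
  exact not_satLit_negLit hvm (hπ _ (h m hm))

/-- A conflict reached by unit propagation alone (no decisions) proves
unsatisfiability. -/
theorem conflict_by_propagation_unsat {V : Type*} [DecidableEq V]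
    (F : Set (Clause V)) (L : List (Lit V))
    (hcons : ∀ l ∈ L, NegLit l ∉ L)
    (hstep : ∀ i : Fin L.length,
      ∃ R ∈ F, UnitIn {l | l ∈ L.take i} R (L.get i))
    (C : Clause V) (hC : C ∈ F) (hfals : Falsified {l | l ∈ L} C) :
    ¬ ∃ v : V → Bool, ∀ D ∈ F, SatClause v D := by
  rintro ⟨v, hv⟩
  have hget : ∀ (n : ℕ) (hn : n < L.length), SatLit v L[n] := by
    intro n
    induction n using Nat.strong_induction_on with
    | _ n ih =>
      intro hn
      obtain ⟨R, hR, hunit⟩ := hstep ⟨n, hn⟩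
      refine hunit.satLit (fun m hm => ?_) (hv R hR)
      obtain ⟨j, hj, rfl⟩ := List.mem_take_iff_getElem.mp hm
      exact ih j (lt_of_lt_of_le hj (min_le_left _ _)) _
  refine hfals.not_satClause (fun m hm => ?_) (hv C hC)
  obtain ⟨j, hj, rfl⟩ := List.mem_iff_getElem.mp hm
  exact hget j hj
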